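/- Representation of monotone operators: let L be a frame and m : L → L a monotone map. Define the relation x R_m y iff x ≤ m y, and for X ⊆ L set ⟨R_m⟩X = {x ∈ L | ∃ y ∈ X, x ≤ m y}. Then for every a ∈ L, ⟨R_m⟩{y | y ≤ a} = {y | y ≤ m a}. Consequently ⟨R_m⟩ maps propositions of the cover system (L, ⊑, ▷) to propositions, and the order isomorphism a ↦ {y | y ≤ a} from L onto the propositions intertwines m with ⟨R_m⟩, i.e. the algebra (L, m) is isomorphic to the algebra of propositions equipped with ⟨R_m⟩. -/

import Mathlib

namespace FrameCover

variable {L : Type*} [Order.Frame L]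

/-- The covering relation on a frame: `x ▷ C` iff `x = sSup C`. -/
def cov (x : L) (C : Set L) : Prop := x = sSup C

/-- `j X = {x | ∃ C, x ▷ C and C ⊆ X}`. -/
def j (X : Set L) : Set L := {x | ∃ C, cov x C ∧ C ⊆ X}

/-- A proposition of the cover system `(L, ⊑, ▷)`: an up-set with respect to
the reversed order `⊑` (i.e. a `≤`-downward-closed set) that is localised. -/
def IsProp (X : Set L) : Prop := IsLowerSet X ∧ j X ⊆ X

/-- The operator `⟨R_m⟩X = {x | ∃ y ∈ X, x R_m y} = {x | ∃ y ∈ X, x ≤ m y}`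
induced by the relation `x R_m y ↔ x ≤ m y`. -/
def diaR (m : L → L) (X : Set L) : Set L := {x | ∃ y ∈ X, x ≤ m y}

end FrameCover

open FrameCover in
/-- Representation of monotone operators: for a frame `L` and a monotone
`m : L → L`, with `x R_m y ↔ x ≤ m y`, one has
`⟨R_m⟩{y | y ≤ a} = {y | y ≤ m a}` for all `a`.  Consequently `⟨R_m⟩` maps
propositions of the cover system `(L, ⊑, ▷)` to propositions, and the order
isomorphism `a ↦ {y | y ≤ a}` intertwines `m` with `⟨R_m⟩`, i.e. the algebra
`(L, m)` is isomorphic to the algebra of propositions equipped with `⟨R_m⟩`. -/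
theorem frame_monotone_operator_representation {L : Type*} [Order.Frame L]
    (m : L → L) (hm : Monotone m) :
    (∀ a : L, diaR m (Set.Iic a) = Set.Iic (m a)) ∧
    (∀ X : Set L, IsProp X → IsProp (diaR m X)) := by
  have h1 : ∀ a : L, diaR m (Set.Iic a) = Set.Iic (m a) := by
    intro a
    ext x
    constructor
    · rintro ⟨y, hy, hx⟩
      exact le_trans hx (hm hy)
    · intro hx
      exact ⟨a, le_refl a, hx⟩
  refine ⟨h1, ?_⟩
  intro X hX
  have hXe : X = Set.Iic (sSup X) := by
    ext x
    constructor
    · intro hx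
      exact le_sSup hx
    · intro hx
      exact hX.1 hx (hX.2 ⟨X, rfl, subset_rfl⟩)
  rw [hXe, h1]
  refine ⟨isLowerSet_Iic _, ?_⟩
  rintro x ⟨C, hC, hCX⟩
  have hx : x = sSup C := hC
  rw [hx]
  exact sSup_le fun c hc => hCX hc
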